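/- For the AdaGrad-with-momentum iterates with f L-smooth and bounded below, if the pointwise noise condition holds and β ∈ [0,1), then for any t ≥ 1: Σ_{s=1}^t Σ_{i=1}^d ḡ_{s,i}·(1/a_{s,i} − 1/b_{s,i})·g_{s,i} ≤ (1/4)·Σ_{s=1}^t Σ_{i=1}^d ḡ_{s,i}²/a_{s,i} + Σ_{s=1}^t G_s·Σ_{i=1}^d g_{s,i}²/b_{s,i}². -/

import Mathlib

open MeasureTheory Finset Real

/-- If `f ≥ c` has an `L`-Lipschitz gradient, then `‖∇f(p)‖² ≤ 2L(f(p) - c)`. -/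
theorem norm_gradient_sq_le {E : Type*} [NormedAddCommGroup E] [InnerProductSpace ℝ E]
    [CompleteSpace E] {f : E → ℝ} {f' : E → E} (hf : ∀ p, HasGradientAt f (f' p) p)
    {L : ℝ} (hL : 0 < L) (hlip : ∀ p q, ‖f' p - f' q‖ ≤ L * ‖p - q‖)
    {c : ℝ} (hc : ∀ p, c ≤ f p) (p : E) :
    ‖f' p‖ ^ 2 ≤ 2 * L * (f p - c) := by
  set n := ‖f' p‖ ^ 2 with hn
  have hpath (t : ℝ) : HasDerivAt (fun t : ℝ => p - t • f' p) (-f' p) t := by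
    simpa using ((hasDerivAt_id t).smul_const (f' p)).const_sub p
  have hderiv (t : ℝ) : HasDerivAt
      (fun t : ℝ => f (p - t • f' p) + t * n - L * n / 2 * t ^ 2)
      (inner ℝ (f' (p - t • f' p)) (-f' p) + n - L * n * t) t := by
    have h₁ := (hf (p - t • f' p)).hasFDerivAt.comp_hasDerivAt t (hpath t)
    refine ((h₁.add ((hasDerivAt_id t).mul_const n)).sub
      (((hasDerivAt_id t).pow 2).const_mul (L * n / 2))).congr_deriv ?_
    simp
    ring
  have hanti : AntitoneOn (fun t : ℝ => f (p - t • f' p) + t * n - L * n / 2 * t ^ 2)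
      (Set.Ici 0) := by
    refine antitoneOn_of_deriv_nonpos (convex_Ici 0)
      (fun t _ => (hderiv t).continuousAt.continuousWithinAt)
      (fun t _ => (hderiv t).differentiableAt.differentiableWithinAt) fun t ht => ?_
    rw [interior_Ici, Set.mem_Ioi] at ht
    rw [(hderiv t).deriv]
    have hcs := real_inner_le_norm (f' (p - t • f' p) - f' p) (-f' p)
    have hl := hlip (p - t • f' p) p
    rw [sub_sub_cancel_left, norm_neg, norm_smul, Real.norm_of_nonneg ht.le] at hl
    rw [norm_neg, inner_sub_left, inner_neg_right (f' p), real_inner_self_eq_norm_sq] at hcs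
    nlinarith [mul_le_mul_of_nonneg_right hl (norm_nonneg (f' p))]
  have hle := hanti (Set.mem_Ici.2 le_rfl) (Set.mem_Ici.2 (one_div_pos.2 hL).le)
    (one_div_pos.2 hL).le
  have hlow := hc (p - (1 / L) • f' p)
  simp only [zero_smul, sub_zero, zero_mul, add_zero, ne_eq, OfNat.ofNat_ne_zero,
    not_false_eq_true, zero_pow, mul_zero] at hle
  have hval : 1 / L * n - L * n / 2 * (1 / L) ^ 2 = n / (2 * L) := by
    field_simp
    ring
  have : n / (2 * L) ≤ f p - c := by linarith
  rw [div_le_iff₀ (by positivity)] at this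
  linarith

/-- The coordinatewise error of replacing an AdaGrad step size by its proxy. -/
theorem mul_one_div_sub_one_div_mul_le {y g v G ε a b : ℝ} (hv : 0 ≤ v) (hG : 0 ≤ G)
    (hgG : g ^ 2 ≤ G ^ 2) (hε : 0 < ε) (ha : a = √(v + G ^ 2) + ε)
    (hb : b = √(v + g ^ 2) + ε) :
    y * (1 / a - 1 / b) * g ≤ 1 / 4 * (y ^ 2 / a) + G * (g ^ 2 / b ^ 2) := by
  have ha0 : 0 < a := by rw [ha]; positivity
  have hb0 : 0 < b := by rw [hb]; positivity
  have hGa : G ≤ a := by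
    have : G ≤ √(v + G ^ 2) := Real.le_sqrt_of_sq_le (by linarith)
    linarith
  have hba : b ≤ a := by
    rw [ha, hb]
    gcongr
  have hab : a ≤ b + G := by
    have : √(v + G ^ 2) ≤ √(v + g ^ 2) + G := by
      rw [Real.sqrt_le_left (by positivity)]
      nlinarith [Real.sq_sqrt (by positivity : 0 ≤ v + g ^ 2),
        mul_nonneg (Real.sqrt_nonneg (v + g ^ 2)) hG, sq_nonneg g]
    linarith
  have hsq : (b - a) ^ 2 ≤ G * a := by nlinarith
  calc y * (1 / a - 1 / b) * g
      ≤ 1 / 4 * (y ^ 2 / a) + (b - a) ^ 2 / a * (g ^ 2 / b ^ 2) := by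
        have key : 1 / 4 * (y ^ 2 / a) + (b - a) ^ 2 / a * (g ^ 2 / b ^ 2)
            - y * (1 / a - 1 / b) * g = (y / 2 - (b - a) * (g / b)) ^ 2 / a := by
          field_simp
          ring
        have : 0 ≤ (y / 2 - (b - a) * (g / b)) ^ 2 / a := by positivity
        linarith
    _ ≤ 1 / 4 * (y ^ 2 / a) + G * (g ^ 2 / b ^ 2) := by
        gcongr
        exact (div_le_iff₀ ha0).2 hsq

theorem stmt_7
    {d : ℕ} (β η ε : ℝ) (hβ0 : 0 ≤ β) (hβ1 : β < 1) (hη : 0 < η) (hε : 0 < ε)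
    (g v m x : ℕ → EuclideanSpace ℝ (Fin d))
    (hv0 : v 0 = 0) (hm0 : m 0 = 0) (hx0 : x 0 = x 1)
    (hv : ∀ s, 1 ≤ s → ∀ i, v s i = v (s - 1) i + g s i ^ 2)
    (hmrec : ∀ s, 1 ≤ s → ∀ i,
      m s i = β * m (s - 1) i - η * g s i / (Real.sqrt (v s i) + ε))
    (hxrec : ∀ s, 1 ≤ s → x (s + 1) = x s + m s)
    (f : EuclideanSpace ℝ (Fin d) → ℝ) (fgrad : EuclideanSpace ℝ (Fin d) → EuclideanSpace ℝ (Fin d))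
    (hgrad : ∀ p, HasGradientAt f (fgrad p) p)
    (L : ℝ) (hL : 0 < L)
    (hsmooth : ∀ p q, ‖fgrad p - fgrad q‖ ≤ L * ‖p - q‖)
    (fstar : ℝ) (hfstar : ∀ p, fstar ≤ f p)
    (A B C : ℝ) (hA : 0 < A) (hB : 0 < B) (hC : 0 < C)
    (hnoise : ∀ s, 1 ≤ s →
      ‖g s - fgrad (x s)‖ ^ 2 ≤ A * (f (x s) - fstar) + B * ‖fgrad (x s)‖ ^ 2 + C)
    (X : ℝ) (hX : X = 2 * A + 4 * L * B + 4 * L)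
    (Gs : ℕ → ℝ) (hGs : ∀ s, Gs s = Real.sqrt (X * (f (x s) - fstar) + 2 * C))
    (a b : ℕ → Fin d → ℝ)
    (ha : ∀ s i, a s i = Real.sqrt (v (s - 1) i + Gs s ^ 2) + ε)
    (hb : ∀ s i, b s i = Real.sqrt (v s i) + ε)
 :
    ∀ t, 1 ≤ t →
      ∑ s ∈ Finset.Icc 1 t, ∑ i, fgrad (x s) i * (1 / a s i - 1 / b s i) * g s i ≤
        1 / 4 * ∑ s ∈ Finset.Icc 1 t, ∑ i, fgrad (x s) i ^ 2 / a s i +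
          ∑ s ∈ Finset.Icc 1 t, Gs s * ∑ i, g s i ^ 2 / b s i ^ 2 := by
  intro t _
  have hv_nonneg : ∀ s i, 0 ≤ v s i := by
    intro s i
    induction s with
    | zero => simp [hv0]
    | succ s ih =>
      rw [hv (s + 1) (by omega) i, Nat.add_sub_cancel]
      positivity
  rw [Finset.mul_sum, ← Finset.sum_add_distrib]
  refine Finset.sum_le_sum fun s hs => ?_
  rw [Finset.mul_sum, Finset.mul_sum, ← Finset.sum_add_distrib]
  refine Finset.sum_le_sum fun i _ => ?_
  have hs1 : 1 ≤ s := (Finset.mem_Icc.1 hs).1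
  have hΔ : 0 ≤ f (x s) - fstar := sub_nonneg.2 (hfstar _)
  have hG_sq : Gs s ^ 2 = X * (f (x s) - fstar) + 2 * C := by
    rw [hGs, Real.sq_sqrt]
    rw [hX]
    positivity
  have hgrad_sq := norm_gradient_sq_le hgrad hL hsmooth hfstar (x s)
  have hg_norm : ‖g s‖ ^ 2 ≤ 2 * ‖g s - fgrad (x s)‖ ^ 2 + 2 * ‖fgrad (x s)‖ ^ 2 := by
    have htri := norm_add_le (g s - fgrad (x s)) (fgrad (x s))
    rw [sub_add_cancel] at htri
    nlinarith [norm_nonneg (g s), sq_nonneg (‖g s - fgrad (x s)‖ - ‖fgrad (x s)‖)]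
  have hcoord : g s i ^ 2 ≤ ‖g s‖ ^ 2 := by
    have := PiLp.norm_apply_le (g s) i
    rw [Real.norm_eq_abs] at this
    rw [← sq_abs]
    gcongr
  have hgG : g s i ^ 2 ≤ Gs s ^ 2 := by
    rw [hG_sq, hX]
    nlinarith [hnoise s hs1, mul_le_mul_of_nonneg_left hgrad_sq hB.le]
  exact mul_one_div_sub_one_div_mul_le (hv_nonneg (s - 1) i)
    (by rw [hGs]; positivity) hgG hε (ha s i) (by rw [hb, hv s hs1])
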